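/- arXiv:2301.02715 — 7 statements merged into one kernel-verified Lean document; each statement's English description precedes it below -/
import Mathlib

section
/- Let 𝔈 (elements) and 𝔉 (internal faces) be finite sets, where each face F ∈ 𝔉 is assigned two distinct elements e₁(F), e₂(F) ∈ 𝔈, a length ℓ_F > 0, and a symmetric real m×m flux matrix C_F with flux decomposition C_F = C_F⁺ + C_F⁻ (C_F⁺ symmetric psd, −C_F⁻ symmetric psd), |C_F| := C_F⁺ − C_F⁻. For E incident to F let σ(E,F) = +1 if E = e₁(F) and −1 if E = e₂(F). Assume the closedness condition: for every element E ∈ 𝔈, Σ_{F incident to E} σ(E,F) ℓ_F C_F = 0. Then for every assignment of states u : 𝔈 → ℝᵐ, the upwind form satisfies the identity Σ_{F∈𝔉} ℓ_F [⟨C_F · ½(u_{e₁(F)} + u_{e₂(F)}), u_{e₁(F)} − u_{e₂(F)}⟩ + ½⟨|C_F|(u_{e₁(F)} − u_{e₂(F)}), u_{e₁(F)} − u_{e₂(F)}⟩] = ½ Σ_{F∈𝔉} ℓ_F ⟨|C_F|(u_{e₁(F)} − u_{e₂(F)}), u_{e₁(F)} − u_{e₂(F)}⟩, and in particular this quantity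 is nonnegative. -/
open Matrix BigOperators

/-- nonnegativity of the upwind bilinear form on its diagonal,
mesh-free formulation. `E` is the (finite) set of elements, `F` the set of internal
faces; each face `f` has incident elements `e₁ f ≠ e₂ f`, length `ℓ f > 0` and a flux
matrix `C f = Cp f + Cm f` with `Cp f` symmetric psd and `-(Cm f)` symmetric psd;
`|C f| = Cp f - Cm f`. The closedness condition says that for each element the
signed, length-weighted sum of flux matrices over its incident faces vanishes.
Then the upwind form evaluated at `(u, u)` equals the jump dissipation term and in
particular is nonnegative. -/
theorem stmt_1 (m : ℕ) (E F : Type) [Fintype E] [Fintype F] [DecidableEq E]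
    (e₁ e₂ : F → E) (hdist : ∀ f, e₁ f ≠ e₂ f)
    (ℓ : F → ℝ) (hℓ : ∀ f, 0 < ℓ f)
    (Cp Cm : F → Matrix (Fin m) (Fin m) ℝ)
    (hCpSymm : ∀ f, (Cp f)ᵀ = Cp f) (hCmSymm : ∀ f, (Cm f)ᵀ = Cm f)
    (hCpPsd : ∀ f (x : Fin m → ℝ), 0 ≤ x ⬝ᵥ (Cp f).mulVec x)
    (hCmPsd : ∀ f (x : Fin m → ℝ), 0 ≤ x ⬝ᵥ (-(Cm f)).mulVec x)
    (hclosed : ∀ el : E,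
      ∑ f : F, (((if e₁ f = el then (1 : ℝ) else 0) - (if e₂ f = el then (1 : ℝ) else 0))
        * ℓ f) • (Cp f + Cm f) = 0) :
    ∀ u : E → (Fin m → ℝ),
      (∑ f : F, ℓ f *
          ((Cp f + Cm f).mulVec ((1 / 2 : ℝ) • (u (e₁ f) + u (e₂ f))) ⬝ᵥ (u (e₁ f) - u (e₂ f))
            + (1 / 2) * ((Cp f - Cm f).mulVec (u (e₁ f) - u (e₂ f)) ⬝ᵥ (u (e₁ f) - u (e₂ f))))
        = (1 / 2) * ∑ f : F, ℓ f *
            ((Cp f - Cm f).mulVec (u (e₁ f) - u (e₂ f)) ⬝ᵥ (u (e₁ f) - u (e₂ f))))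
      ∧ 0 ≤ ∑ f : F, ℓ f *
          ((Cp f + Cm f).mulVec ((1 / 2 : ℝ) • (u (e₁ f) + u (e₂ f))) ⬝ᵥ (u (e₁ f) - u (e₂ f))
            + (1 / 2) * ((Cp f - Cm f).mulVec (u (e₁ f) - u (e₂ f)) ⬝ᵥ (u (e₁ f) - u (e₂ f)))) := by
  intro u
  have hsym : ∀ f (a b : Fin m → ℝ),
      (Cp f + Cm f).mulVec a ⬝ᵥ b = (Cp f + Cm f).mulVec b ⬝ᵥ a := by
    intro f a b
    have h : (Cp f + Cm f)ᵀ = Cp f + Cm f := by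
      rw [Matrix.transpose_add, hCpSymm, hCmSymm]
    rw [dotProduct_comm, Matrix.dotProduct_mulVec, ← Matrix.mulVec_transpose, h]
  have hface : ∀ f, (Cp f + Cm f).mulVec ((1 / 2 : ℝ) • (u (e₁ f) + u (e₂ f))) ⬝ᵥ
      (u (e₁ f) - u (e₂ f)) = (1 / 2) * ((Cp f + Cm f).mulVec (u (e₁ f)) ⬝ᵥ u (e₁ f)
        - (Cp f + Cm f).mulVec (u (e₂ f)) ⬝ᵥ u (e₂ f)) := by
    intro f
    have h := hsym f (u (e₁ f)) (u (e₂ f))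
    rw [Matrix.mulVec_smul, Matrix.mulVec_add, smul_dotProduct, add_dotProduct,
      dotProduct_sub, dotProduct_sub, smul_eq_mul, h]
    ring
  have hel : ∀ el : E, ∑ f : F, ((if e₁ f = el then (1 : ℝ) else 0)
      - (if e₂ f = el then (1 : ℝ) else 0)) * ℓ f * ((Cp f + Cm f).mulVec (u el) ⬝ᵥ u el) = 0 := by
    intro el
    have h := congrArg (fun M : Matrix (Fin m) (Fin m) ℝ => M.mulVec (u el) ⬝ᵥ u el) (hclosed el)
    simp only [Matrix.sum_mulVec, Matrix.zero_mulVec, zero_dotProduct, sum_dotProduct,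
      Matrix.smul_mulVec, smul_dotProduct, smul_eq_mul] at h
    exact h
  have hzero : ∑ f : F, ℓ f * ((Cp f + Cm f).mulVec (u (e₁ f)) ⬝ᵥ u (e₁ f)
        - (Cp f + Cm f).mulVec (u (e₂ f)) ⬝ᵥ u (e₂ f)) = 0 := by
    have h := Finset.sum_eq_zero (s := Finset.univ) (fun el _ => hel el)
    rw [Finset.sum_comm] at h
    rw [← h]
    refine Finset.sum_congr rfl fun f _ => ?_
    simp only [sub_mul, Finset.sum_sub_distrib, ite_mul, one_mul, zero_mul,
      Finset.sum_ite_eq, Finset.mem_univ, if_true]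
    ring
  have key : (∑ f : F, ℓ f *
          ((Cp f + Cm f).mulVec ((1 / 2 : ℝ) • (u (e₁ f) + u (e₂ f))) ⬝ᵥ (u (e₁ f) - u (e₂ f))
            + (1 / 2) * ((Cp f - Cm f).mulVec (u (e₁ f) - u (e₂ f)) ⬝ᵥ (u (e₁ f) - u (e₂ f))))
        = (1 / 2) * ∑ f : F, ℓ f *
            ((Cp f - Cm f).mulVec (u (e₁ f) - u (e₂ f)) ⬝ᵥ (u (e₁ f) - u (e₂ f)))) := by
    rw [← zero_add ((1 / 2 : ℝ) * _), ← mul_zero (1 / 2 : ℝ), ← hzero, Finset.mul_sum,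
      Finset.mul_sum, ← Finset.sum_add_distrib]
    refine Finset.sum_congr rfl fun f _ => ?_
    rw [hface]
    ring
  refine ⟨key, ?_⟩
  rw [key]
  refine mul_nonneg (by norm_num) (Finset.sum_nonneg fun f _ => mul_nonneg (hℓ f).le ?_)
  have h1 := hCpPsd f (u (e₁ f) - u (e₂ f))
  have h2 := hCmPsd f (u (e₁ f) - u (e₂ f))
  rw [dotProduct_comm, sub_eq_add_neg (Cp f), Matrix.add_mulVec, dotProduct_add]
  exact add_nonneg h1 h2
end

section
/- Let ι be a finite index set (the faces of a cut-cell). For each j ∈ ι let K_j be a symmetric real m×m matrix, and for each i ∈ ι let ω_i be a real m×m matrix such that Σ_{i∈ι} ω_i = Id and such that ω_i K_j is symmetric for all i, j ∈ ι. Then for every u_c ∈ ℝᵐ and every family (u_i)_{i∈ι} of vectors in ℝᵐ: Σ_{j∈ι} ⟨(Σ_{i∈ι} ω_i K_j u_i) − K_j u_c, u_c − u_j⟩ = −½ Σ_{j∈ι} [ ⟨K_j (u_c − u_j), u_c − u_j⟩ + Σ_{i∈ι} ⟨ω_i K_j (u_i − u_c), u_i − u_c⟩ − Σ_{i∈ι}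 ⟨ω_i K_j (u_i − u_j), u_i − u_j⟩ ]. -/
open Matrix BigOperators

/-- algebraic rearrangement identity for the DoD stabilization term
`J_h^{0,E_cut}(u,u)` on a single cut-cell. `K j` plays the role of `C_{F_j}⁺`,
`uc` is the value on the cut-cell, `u j` the neighbor value across face `j`, and the
weight matrices `ω i` satisfy `∑ i, ω i = 1` and `ω i * K j` symmetric. -/
theorem stmt_2 (m : ℕ) (ι : Type) [Fintype ι]
    (K ω : ι → Matrix (Fin m) (Fin m) ℝ)
    (hKsymm : ∀ j, (K j)ᵀ = K j)
    (hωsum : ∑ i, ω i = 1)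
    (hωKsymm : ∀ i j, (ω i * K j)ᵀ = ω i * K j) :
    ∀ (uc : Fin m → ℝ) (u : ι → Fin m → ℝ),
      ∑ j, (((∑ i, (ω i * K j).mulVec (u i)) - (K j).mulVec uc) ⬝ᵥ (uc - u j))
        = -(1 / 2) * ∑ j,
            (((K j).mulVec (uc - u j) ⬝ᵥ (uc - u j))
              + (∑ i, ((ω i * K j).mulVec (u i - uc) ⬝ᵥ (u i - uc)))
              - (∑ i, ((ω i * K j).mulVec (u i - u j) ⬝ᵥ (u i - u j)))) := by
  intro uc u
  have hK : ∀ j (v : Fin m → ℝ), (K j).mulVec v = ∑ i, (ω i * K j).mulVec v := by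
    intro j v
    rw [← Matrix.sum_mulVec, ← Finset.sum_mul, hωsum, one_mul]
  rw [Finset.mul_sum]
  refine Finset.sum_congr rfl fun j _ => ?_
  rw [hK j uc, hK j (uc - u j), ← Finset.sum_sub_distrib, sum_dotProduct, sum_dotProduct,
    ← Finset.sum_add_distrib, ← Finset.sum_sub_distrib, Finset.mul_sum]
  refine Finset.sum_congr rfl fun i _ => ?_
  have key : ∀ a b : Fin m → ℝ,
      (ω i * K j).mulVec b ⬝ᵥ a = (ω i * K j).mulVec a ⬝ᵥ b := by
    intro a b
    rw [dotProduct_comm, Matrix.dotProduct_mulVec, ← Matrix.mulVec_transpose, hωKsymm]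
  have e : u i - u j = (u i - uc) + (uc - u j) := by abel
  rw [← Matrix.mulVec_sub, e]
  generalize u i - uc = a
  generalize uc - u j = b
  rw [Matrix.mulVec_add, add_dotProduct, dotProduct_add, dotProduct_add, key a b]
  ring
end

section
/- Let ι be a finite index set. For each j ∈ ι let ℓ_j > 0 and let C_j⁺, C_j⁻ be real m×m matrices with C_j⁺ symmetric positive semidefinite and −C_j⁻ symmetric positive semidefinite; write |C_j| := C_j⁺ − C_j⁻. For each i ∈ ι let ω_i be a real m×m matrix such that: (i) Σ_{i∈ι} ω_i = Id; (ii) ω_i C_j⁺ is symmetric positive semidefinite for all i, j ∈ ι; (iii) Σ_{j∈ι} ℓ_j ω_i C_j⁺ = −ℓ_i C_i⁻ for every i ∈ ι. Then for every u_c ∈ ℝᵐ and every family (u_j)_{j∈ι} in ℝᵐ: Σ_{j∈ι} ℓ_j ⟨(Σ_{i∈ι} ω_i C_j⁺ u_i) − C_j⁺ u_c, u_c − u_j⟩ ≥ −½ Σ_{j∈ι} ℓ_j ⟨|C_j| (u_c − u_j), u_c − u_j⟩. -/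
open Matrix BigOperators

/-- per-cut-cell lower bound for the DoD stabilization term.
`ι` indexes the faces of a small cut-cell, `ℓ j > 0` the face measures, `Cp j`
(symmetric psd) and `Cm j` (with `-(Cm j)` symmetric psd) the positive and negative
parts of the outward flux matrix, `|C j| = Cp j - Cm j`. The weights `ω i` satisfy
(i) `∑ i, ω i = 1`, (ii) `ω i * Cp j` symmetric psd, (iii) the flux-distribution
condition `∑ j, ℓ j • (ω i * Cp j) = -(ℓ i • Cm i)`. Then the stabilization term is
bounded below by the (negative) upwind dissipation on the faces of the cut-cell. -/
theorem stmt_3 (m : ℕ) (ι : Type) [Fintype ι]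
    (ℓ : ι → ℝ) (hℓ : ∀ j, 0 < ℓ j)
    (Cp Cm : ι → Matrix (Fin m) (Fin m) ℝ)
    (hCpSymm : ∀ j, (Cp j)ᵀ = Cp j) (hCmSymm : ∀ j, (Cm j)ᵀ = Cm j)
    (hCpPsd : ∀ j (x : Fin m → ℝ), 0 ≤ x ⬝ᵥ (Cp j).mulVec x)
    (hCmPsd : ∀ j (x : Fin m → ℝ), 0 ≤ x ⬝ᵥ (-(Cm j)).mulVec x)
    (ω : ι → Matrix (Fin m) (Fin m) ℝ)
    (hωsum : ∑ i, ω i = 1)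
    (hωCpSymm : ∀ i j, (ω i * Cp j)ᵀ = ω i * Cp j)
    (hωCpPsd : ∀ i j (x : Fin m → ℝ), 0 ≤ x ⬝ᵥ (ω i * Cp j).mulVec x)
    (hdistr : ∀ i, ∑ j, ℓ j • (ω i * Cp j) = -(ℓ i • Cm i)) :
    ∀ (uc : Fin m → ℝ) (u : ι → Fin m → ℝ),
      ∑ j, ℓ j * (((∑ i, (ω i * Cp j).mulVec (u i)) - (Cp j).mulVec uc) ⬝ᵥ (uc - u j))
        ≥ -(1 / 2) * ∑ j, ℓ j * ((Cp j - Cm j).mulVec (uc - u j) ⬝ᵥ (uc - u j)) := by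
  intro uc u
  have hCp : ∀ j, Cp j = ∑ i, ω i * Cp j := by
    intro j
    rw [← Finset.sum_mul, hωsum, one_mul]
  -- the weighted Young inequality
  have young : ∀ i j (x y : Fin m → ℝ),
      (ω i * Cp j).mulVec x ⬝ᵥ y ≤
        1 / 2 * ((ω i * Cp j).mulVec x ⬝ᵥ x + (ω i * Cp j).mulVec y ⬝ᵥ y) := by
    intro i j x y
    have h := hωCpPsd i j (x - y)
    have hs : (ω i * Cp j).mulVec y ⬝ᵥ x = (ω i * Cp j).mulVec x ⬝ᵥ y := by
      rw [dotProduct_comm, dotProduct_mulVec, ← mulVec_transpose, hωCpSymm]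
    rw [dotProduct_comm, mulVec_sub, sub_dotProduct, dotProduct_sub, dotProduct_sub] at h
    linarith
  have hL : ∀ j, ((∑ i, (ω i * Cp j).mulVec (u i)) - (Cp j).mulVec uc) ⬝ᵥ (uc - u j)
      = -∑ i, (ω i * Cp j).mulVec (uc - u i) ⬝ᵥ (uc - u j) := by
    intro j
    have h1 : (Cp j).mulVec uc = ∑ i, (ω i * Cp j).mulVec uc := by
      conv_lhs => rw [hCp j]
      rw [sum_mulVec]
    rw [h1, ← Finset.sum_sub_distrib, sum_dotProduct, ← Finset.sum_neg_distrib]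
    refine Finset.sum_congr rfl fun i _ => ?_
    rw [← mulVec_sub, ← neg_dotProduct, ← mulVec_neg, neg_sub]
  have hP : ∀ j, (Cp j).mulVec (uc - u j) ⬝ᵥ (uc - u j)
      = ∑ i, (ω i * Cp j).mulVec (uc - u j) ⬝ᵥ (uc - u j) := by
    intro j
    conv_lhs => rw [hCp j]
    rw [sum_mulVec, sum_dotProduct]
  have hM : ∀ i, ∑ j, ℓ j * ((ω i * Cp j).mulVec (uc - u i) ⬝ᵥ (uc - u i))
      = -(ℓ i * ((Cm i).mulVec (uc - u i) ⬝ᵥ (uc - u i))) := by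
    intro i
    have h := congrArg (fun M => M.mulVec (uc - u i) ⬝ᵥ (uc - u i)) (hdistr i)
    simpa only [sum_mulVec, sum_dotProduct, smul_mulVec, smul_dotProduct, neg_mulVec,
      neg_dotProduct, smul_eq_mul] using h
  have hM' : ∑ j, ∑ i, ℓ j * ((ω i * Cp j).mulVec (uc - u i) ⬝ᵥ (uc - u i))
      = -∑ i, ℓ i * ((Cm i).mulVec (uc - u i) ⬝ᵥ (uc - u i)) := by
    rw [Finset.sum_comm, ← Finset.sum_neg_distrib]
    exact Finset.sum_congr rfl fun i _ => hM i
  have hR : ∑ j, ℓ j * ((Cp j - Cm j).mulVec (uc - u j) ⬝ᵥ (uc - u j))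
      = ∑ j, ∑ i, ℓ j * ((ω i * Cp j).mulVec (uc - u i) ⬝ᵥ (uc - u i)
          + (ω i * Cp j).mulVec (uc - u j) ⬝ᵥ (uc - u j)) := by
    simp only [mul_add, Finset.sum_add_distrib]
    rw [hM']
    simp only [← Finset.mul_sum, ← hP]
    simp only [sub_mulVec, sub_dotProduct, mul_sub, Finset.sum_sub_distrib]
    ring
  rw [hR, ge_iff_le, Finset.mul_sum]
  refine Finset.sum_le_sum fun j _ => ?_
  rw [hL, ← Finset.mul_sum]
  have h := Finset.sum_le_sum fun i (_ : i ∈ Finset.univ) => young i j (uc - u i) (uc - u j)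
  rw [← Finset.mul_sum] at h
  nlinarith [mul_le_mul_of_nonneg_left h (hℓ j).le]
end

section
/- Let 𝔈 and 𝔉 be finite sets, where each face F ∈ 𝔉 has two distinct incident elements e₁(F), e₂(F) ∈ 𝔈, a length ℓ_F > 0, and a symmetric real m×m matrix C_F with flux decomposition C_F = C_F⁺ + C_F⁻ (C_F⁺ symmetric psd, −C_F⁻ symmetric psd), |C_F| := C_F⁺ − C_F⁻. For E incident to F set σ(E,F) = +1 if E = e₁(F), −1 if E = e₂(F); let nbr(E,F) denote the other element of F; and define the outward positive part P(E,F) := C_F⁺ if σ(E,F)=+1 and P(E,F) := −C_F⁻ if σ(E,F)=−1, and the outward negative part N(E,F) := C_F⁻ if σ(E,F)=+1 and N(E,F) := −C_F⁺ if σ(E,F)=−1. Assume: (closedness) for every E ∈ 𝔈, Σ_{F incident to E} σ(E,F) ℓ_F C_F = 0. Let I ⊆ 𝔈 be a set of stabilized cells such that no two elements of I share a face, and for each E ∈ I let η_E ∈ [0,1] and, for each face F_i incident to E, let ω_{E,i} be an m×m matrix such that: (i) Σ_i ω_{E,i} = Id; (ii) ω_{E,i} P(E,F_j) is symmetric positive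 semidefinite for all incident faces F_i, F_j; (iii) Σ_j ℓ_{F_j} ω_{E,i} P(E,F_j) = −ℓ_{F_i} N(E,F_i) for every incident face F_i. Then for every u : 𝔈 → ℝᵐ, the stabilized quadratic form is nonnegative: Σ_{F∈𝔉} ℓ_F [⟨C_F · ½(u_{e₁(F)}+u_{e₂(F)}), u_{e₁(F)}−u_{e₂(F)}⟩ + ½⟨|C_F|(u_{e₁(F)}−u_{e₂(F)}), u_{e₁(F)}−u_{e₂(F)}⟩] + Σ_{E∈I} η_E Σ_{F_j incident to E} ℓ_{F_j} ⟨(Σ_{F_i incident to E} ω_{E,i} P(E,F_j) u_{nbr(E,F_i)}) − P(E,F_j) u_E, u_E − u_{nbr(E,F_j)}⟩ ≥ 0. -/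
open Matrix BigOperators

/-- The set of faces incident to the element `el`. -/
def facesOf {E F : Type} [Fintype F] [DecidableEq E] (e₁ e₂ : F → E) (el : E) : Finset F :=
  Finset.univ.filter (fun f => e₁ f = el ∨ e₂ f = el)

/-- The outward positive flux part `P(el, f)` of face `f` seen from element `el`:
`C_f⁺` if `el = e₁ f` (orientation `+1`) and `-C_f⁻` if `el = e₂ f` (orientation `-1`). -/
def outP {m : ℕ} {E F : Type} [DecidableEq E] (e₁ : F → E)
    (Cp Cm : F → Matrix (Fin m) (Fin m) ℝ) (el : E) (f : F) : Matrix (Fin m) (Fin m) ℝ :=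
  if e₁ f = el then Cp f else -(Cm f)

/-- The outward negative flux part `N(el, f)` of face `f` seen from element `el`:
`C_f⁻` if `el = e₁ f` and `-C_f⁺` if `el = e₂ f`. -/
def outN {m : ℕ} {E F : Type} [DecidableEq E] (e₁ : F → E)
    (Cp Cm : F → Matrix (Fin m) (Fin m) ℝ) (el : E) (f : F) : Matrix (Fin m) (Fin m) ℝ :=
  if e₁ f = el then Cm f else -(Cp f)

/-- The neighbor of element `el` across face `f`. -/
def nbr {E F : Type} [DecidableEq E] (e₁ e₂ : F → E) (el : E) (f : F) : E :=
  if e₁ f = el then e₂ f else e₁ f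


/-- Local estimate at one stabilized cell. -/
theorem local_aux {m : ℕ} {F : Type} (s : Finset F) (ℓ : F → ℝ) (hℓ : ∀ f, 0 < ℓ f)
    (P N ω : F → Matrix (Fin m) (Fin m) ℝ) (η : ℝ) (h0 : 0 ≤ η) (h1 : η ≤ 1)
    (hsum : ∑ i ∈ s, ω i = 1)
    (hsymm : ∀ i ∈ s, ∀ j ∈ s, (ω i * P j)ᵀ = ω i * P j)
    (hpsd : ∀ i ∈ s, ∀ j ∈ s, ∀ x : Fin m → ℝ, 0 ≤ x ⬝ᵥ (ω i * P j).mulVec x)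
    (hd : ∀ i ∈ s, ∑ j ∈ s, ℓ j • (ω i * P j) = -(ℓ i • N i))
    (u : Fin m → ℝ) (v : F → Fin m → ℝ) :
    0 ≤ (∑ j ∈ s, ℓ j * ((1 / 2) * ((P j - N j).mulVec (u - v j) ⬝ᵥ (u - v j))))
      + η * ∑ j ∈ s, ℓ j *
        (((∑ i ∈ s, (ω i * P j).mulVec (v i)) - (P j).mulVec u) ⬝ᵥ (u - v j)) := by
  have hP : ∀ j, P j = ∑ i ∈ s, ω i * P j := by
    intro j
    rw [← Finset.sum_mul, hsum, one_mul]
  set w : F → Fin m → ℝ := fun j => u - v j with hw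
  have a1 : ∑ j ∈ s, ℓ j * ((P j).mulVec (w j) ⬝ᵥ w j)
      = ∑ i ∈ s, ∑ j ∈ s, ℓ j * ((ω i * P j).mulVec (w j) ⬝ᵥ w j) := by
    rw [Finset.sum_comm]
    refine Finset.sum_congr rfl fun j _ => ?_
    conv_lhs => rw [hP j]
    rw [Matrix.sum_mulVec, sum_dotProduct, Finset.mul_sum]
  have a2 : -∑ i ∈ s, ℓ i * ((N i).mulVec (w i) ⬝ᵥ w i)
      = ∑ i ∈ s, ∑ j ∈ s, ℓ j * ((ω i * P j).mulVec (w i) ⬝ᵥ w i) := by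
    rw [← Finset.sum_neg_distrib]
    refine Finset.sum_congr rfl fun i hi => ?_
    have := congrArg (fun M : Matrix (Fin m) (Fin m) ℝ => M.mulVec (w i) ⬝ᵥ w i) (hd i hi)
    simp only [Matrix.sum_mulVec, sum_dotProduct, Matrix.smul_mulVec, smul_dotProduct,
      Matrix.neg_mulVec, neg_dotProduct, smul_eq_mul] at this
    exact this.symm
  have a3 : ∑ j ∈ s, ℓ j *
        (((∑ i ∈ s, (ω i * P j).mulVec (v i)) - (P j).mulVec u) ⬝ᵥ (w j))
      = -∑ i ∈ s, ∑ j ∈ s, ℓ j * ((ω i * P j).mulVec (w i) ⬝ᵥ w j) := by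
    rw [Finset.sum_comm, ← Finset.sum_neg_distrib]
    refine Finset.sum_congr rfl fun j _ => ?_
    have : (∑ i ∈ s, (ω i * P j).mulVec (v i)) - (P j).mulVec u
        = -∑ i ∈ s, (ω i * P j).mulVec (w i) := by
      conv_lhs => rw [hP j]
      simp only [hw, Matrix.sum_mulVec, Matrix.mulVec_sub, Finset.sum_sub_distrib]
      rw [← hP j]
      abel
    rw [this, neg_dotProduct, sum_dotProduct, ← Finset.mul_sum, mul_neg]
  have a0 : ∑ j ∈ s, ℓ j * ((1 / 2) * ((P j - N j).mulVec (w j) ⬝ᵥ w j))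
      = (1 / 2) * (∑ j ∈ s, ℓ j * ((P j).mulVec (w j) ⬝ᵥ w j)
        + -∑ i ∈ s, ℓ i * ((N i).mulVec (w i) ⬝ᵥ w i)) := by
    rw [← sub_eq_add_neg, ← Finset.sum_sub_distrib, Finset.mul_sum]
    refine Finset.sum_congr rfl fun j _ => ?_
    rw [Matrix.sub_mulVec, sub_dotProduct]
    ring
  change 0 ≤ (∑ j ∈ s, ℓ j * ((1 / 2) * ((P j - N j).mulVec (w j) ⬝ᵥ w j)))
      + η * ∑ j ∈ s, ℓ j *
        (((∑ i ∈ s, (ω i * P j).mulVec (v i)) - (P j).mulVec u) ⬝ᵥ (w j))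
  rw [a3, a0, a1, a2, ← Finset.sum_add_distrib, ← Finset.sum_neg_distrib, Finset.mul_sum,
    Finset.mul_sum, ← Finset.sum_add_distrib]
  refine Finset.sum_nonneg fun i hi => ?_
  rw [← Finset.sum_add_distrib, ← Finset.sum_neg_distrib, Finset.mul_sum,
    Finset.mul_sum, ← Finset.sum_add_distrib]
  refine Finset.sum_nonneg fun j hj => ?_
  clear a0 a1 a2 a3
  clear_value w
  have q1 := hpsd i hi j hj (w i)
  have q2 := hpsd i hi j hj (w j)
  have q3 := hpsd i hi j hj (w i - w j)
  have q4 : (ω i * P j).mulVec (w j) ⬝ᵥ w i = (ω i * P j).mulVec (w i) ⬝ᵥ w j := by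
    rw [dotProduct_comm, Matrix.dotProduct_mulVec, ← Matrix.mulVec_transpose, hsymm i hi j hj]
  rw [dotProduct_comm] at q1 q2 q3
  rw [Matrix.mulVec_sub, sub_dotProduct, dotProduct_sub, dotProduct_sub, q4] at q3
  generalize (ω i * P j).mulVec (w i) ⬝ᵥ w i = a at *
  generalize (ω i * P j).mulVec (w j) ⬝ᵥ w j = b at *
  generalize (ω i * P j).mulVec (w i) ⬝ᵥ w j = c at *
  have : 1 / 2 * (ℓ j * b + ℓ j * a) + η * -(ℓ j * c)
      = ℓ j * (1 / 2) * ((1 - η) * (a + b) + η * (a - c - (c - b))) := by ring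
  rw [this]
  have := (hℓ j).le
  have : 0 ≤ 1 - η := by linarith
  have : 0 ≤ a + b := by linarith
  positivity

/-- nonnegativity of the DoD-stabilized quadratic form
`a_h^upw(u,u) + J_h^0(u,u)` (mesh-free algebraic core of Theorem 3.1).
`E` are the elements, `F` the internal faces with incident elements `e₁ f ≠ e₂ f`,
measures `ℓ f > 0` and flux decompositions `C f = Cp f + Cm f` (`Cp f` symmetric psd,
`-(Cm f)` symmetric psd, `|C f| = Cp f - Cm f`); closedness encodes the divergence
theorem on each element. `I` is the set of stabilized cut-cells (no two sharing a
face), `η el ∈ [0,1]` the stabilization parameters and `ω el fi` the weight matrices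
satisfying the normalization (i), symmetry/psd (ii) and flux-distribution (iii)
conditions. -/
theorem stmt_4 (m : ℕ) (E F : Type) [Fintype E] [Fintype F] [DecidableEq E]
    (e₁ e₂ : F → E) (hdist : ∀ f, e₁ f ≠ e₂ f)
    (ℓ : F → ℝ) (hℓ : ∀ f, 0 < ℓ f)
    (Cp Cm : F → Matrix (Fin m) (Fin m) ℝ)
    (hCpSymm : ∀ f, (Cp f)ᵀ = Cp f) (hCmSymm : ∀ f, (Cm f)ᵀ = Cm f)
    (hCpPsd : ∀ f (x : Fin m → ℝ), 0 ≤ x ⬝ᵥ (Cp f).mulVec x)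
    (hCmPsd : ∀ f (x : Fin m → ℝ), 0 ≤ x ⬝ᵥ (-(Cm f)).mulVec x)
    (hclosed : ∀ el : E,
      ∑ f : F, (((if e₁ f = el then (1 : ℝ) else 0) - (if e₂ f = el then (1 : ℝ) else 0))
        * ℓ f) • (Cp f + Cm f) = 0)
    (I : Finset E)
    (hIsep : ∀ f : F, ¬(e₁ f ∈ I ∧ e₂ f ∈ I))
    (η : E → ℝ) (hη : ∀ el ∈ I, η el ∈ Set.Icc (0 : ℝ) 1)
    (ω : E → F → Matrix (Fin m) (Fin m) ℝ)
    (hωsum : ∀ el ∈ I, ∑ fi ∈ facesOf e₁ e₂ el, ω el fi = 1)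
    (hωPSymm : ∀ el ∈ I, ∀ fi ∈ facesOf e₁ e₂ el, ∀ fj ∈ facesOf e₁ e₂ el,
      (ω el fi * outP e₁ Cp Cm el fj)ᵀ = ω el fi * outP e₁ Cp Cm el fj)
    (hωPPsd : ∀ el ∈ I, ∀ fi ∈ facesOf e₁ e₂ el, ∀ fj ∈ facesOf e₁ e₂ el,
      ∀ x : Fin m → ℝ, 0 ≤ x ⬝ᵥ (ω el fi * outP e₁ Cp Cm el fj).mulVec x)
    (hdistr : ∀ el ∈ I, ∀ fi ∈ facesOf e₁ e₂ el,
      ∑ fj ∈ facesOf e₁ e₂ el, ℓ fj • (ω el fi * outP e₁ Cp Cm el fj)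
        = -(ℓ fi • outN e₁ Cp Cm el fi)) :
    ∀ u : E → (Fin m → ℝ),
      0 ≤ (∑ f : F, ℓ f *
            ((Cp f + Cm f).mulVec ((1 / 2 : ℝ) • (u (e₁ f) + u (e₂ f))) ⬝ᵥ (u (e₁ f) - u (e₂ f))
              + (1 / 2) * ((Cp f - Cm f).mulVec (u (e₁ f) - u (e₂ f)) ⬝ᵥ (u (e₁ f) - u (e₂ f)))))
          + ∑ el ∈ I, η el * ∑ fj ∈ facesOf e₁ e₂ el, ℓ fj *
              (((∑ fi ∈ facesOf e₁ e₂ el,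
                    (ω el fi * outP e₁ Cp Cm el fj).mulVec (u (nbr e₁ e₂ el fi)))
                  - (outP e₁ Cp Cm el fj).mulVec (u el)) ⬝ᵥ (u el - u (nbr e₁ e₂ el fj))) := by
  intro u
  set T : F → ℝ := fun f => ℓ f * ((1 / 2) *
    ((Cp f - Cm f).mulVec (u (e₁ f) - u (e₂ f)) ⬝ᵥ (u (e₁ f) - u (e₂ f)))) with hT
  have hTnn : ∀ f, 0 ≤ T f := by
    intro f
    have q1 := hCpPsd f (u (e₁ f) - u (e₂ f))
    have q2 := hCmPsd f (u (e₁ f) - u (e₂ f))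
    rw [dotProduct_comm] at q1 q2
    have h := (hℓ f).le
    have : 0 ≤ (Cp f - Cm f).mulVec (u (e₁ f) - u (e₂ f)) ⬝ᵥ (u (e₁ f) - u (e₂ f)) := by
      rw [sub_eq_add_neg (Cp f), Matrix.add_mulVec, add_dotProduct]
      exact add_nonneg q1 q2
    simp only [hT]
    positivity
  have hcent : ∑ f : F, ℓ f * ((Cp f + Cm f).mulVec ((1 / 2 : ℝ) • (u (e₁ f) + u (e₂ f)))
      ⬝ᵥ (u (e₁ f) - u (e₂ f))) = 0 := by
    have key : ∀ f, ℓ f * ((Cp f + Cm f).mulVec ((1 / 2 : ℝ) • (u (e₁ f) + u (e₂ f)))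
      ⬝ᵥ (u (e₁ f) - u (e₂ f))) = ∑ el : E, (1 / 2) *
        ((((if e₁ f = el then (1 : ℝ) else 0) - (if e₂ f = el then (1 : ℝ) else 0))
        * ℓ f) * ((Cp f + Cm f).mulVec (u el) ⬝ᵥ u el)) := by
      intro f
      have q4 : (Cp f + Cm f).mulVec (u (e₂ f)) ⬝ᵥ u (e₁ f)
          = (Cp f + Cm f).mulVec (u (e₁ f)) ⬝ᵥ u (e₂ f) := by
        rw [dotProduct_comm, Matrix.dotProduct_mulVec, ← Matrix.mulVec_transpose,
          Matrix.transpose_add, hCpSymm, hCmSymm]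
      simp only [sub_mul, mul_sub, Finset.sum_sub_distrib, ite_mul, mul_ite, one_mul, zero_mul,
        mul_zero, Finset.sum_ite_eq, Finset.mem_univ, if_true]
      rw [Matrix.mulVec_smul, smul_dotProduct, Matrix.mulVec_add, dotProduct_sub,
        add_dotProduct, add_dotProduct, q4, smul_eq_mul]
      ring
    rw [Finset.sum_congr rfl fun f _ => key f, Finset.sum_comm]
    refine Finset.sum_eq_zero fun el _ => ?_
    rw [← Finset.mul_sum]
    have := congrArg (fun M : Matrix (Fin m) (Fin m) ℝ => M.mulVec (u el) ⬝ᵥ u el) (hclosed el)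
    simp only [Matrix.sum_mulVec, sum_dotProduct, Matrix.smul_mulVec, smul_dotProduct,
      smul_eq_mul, Matrix.zero_mulVec, zero_dotProduct] at this
    rw [this, mul_zero]
  have hloc : ∀ el ∈ I, 0 ≤ (∑ f ∈ facesOf e₁ e₂ el, T f)
      + η el * ∑ fj ∈ facesOf e₁ e₂ el, ℓ fj *
              (((∑ fi ∈ facesOf e₁ e₂ el,
                    (ω el fi * outP e₁ Cp Cm el fj).mulVec (u (nbr e₁ e₂ el fi)))
                  - (outP e₁ Cp Cm el fj).mulVec (u el)) ⬝ᵥ (u el - u (nbr e₁ e₂ el fj))) := by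
    intro el hel
    have h := local_aux (facesOf e₁ e₂ el) ℓ hℓ (outP e₁ Cp Cm el) (outN e₁ Cp Cm el) (ω el)
      (η el) (hη el hel).1 (hη el hel).2 (hωsum el hel) (hωPSymm el hel) (hωPPsd el hel)
      (hdistr el hel) (u el) (fun f => u (nbr e₁ e₂ el f))
    refine h.trans_eq ?_
    congr 1
    refine Finset.sum_congr rfl fun f hf => ?_
    simp only [hT, outP, outN, nbr]
    by_cases h1 : e₁ f = el
    · simp only [h1, if_true]
    · have h2 : e₂ f = el := by
        simp only [facesOf, Finset.mem_filter, Finset.mem_univ, true_and] at hf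
        tauto
      simp only [h1, if_false, h2]
      rw [← neg_sub (u (e₁ f)) (u el), Matrix.mulVec_neg, neg_dotProduct_neg,
        show -Cm f - -Cp f = Cp f - Cm f by abel]
  have hglob : ∑ el ∈ I, ∑ f ∈ facesOf e₁ e₂ el, T f ≤ ∑ f, T f := by
    classical
    rw [← Finset.sum_biUnion]
    · exact Finset.sum_le_sum_of_subset_of_nonneg (Finset.subset_univ _) fun f _ _ => hTnn f
    · intro a ha b hb hab
      rw [Function.onFun, Finset.disjoint_left]
      intro f hfa hfb
      simp only [facesOf, Finset.mem_filter, Finset.mem_univ, true_and] at hfa hfb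
      have ha' : a ∈ I := ha
      have hb' : b ∈ I := hb
      have := hIsep f
      rcases hfa with rfl | rfl <;> rcases hfb with h | h <;> simp_all
  have hs := Finset.sum_nonneg hloc
  rw [Finset.sum_add_distrib] at hs
  simp only [mul_add (ℓ _), Finset.sum_add_distrib]
  rw [hcent, zero_add]
  linarith
end

section
/- Let ι be a finite index set. Let O be a real orthogonal m×m matrix and for each j ∈ ι let Λ_j be a real diagonal m×m matrix; set C_j := O Λ_j Oᵀ, C_j⁺ := O Λ_j⁺ Oᵀ and C_j⁻ := O Λ_j⁻ Oᵀ, where (Λ_j⁺)_{kk} = max(0, (Λ_j)_{kk}) and (Λ_j⁻)_{kk} = min(0, (Λ_j)_{kk}). Let ℓ_j > 0 for each j ∈ ι, assume Σ_{j∈ι} ℓ_j C_j = 0, and assume that the matrix S := Σ_{k∈ι} ℓ_k C_k⁻ is invertible. Define ω_i := ℓ_i C_i⁻ S⁻¹ for each i ∈ ι. Then: (a) Σ_{i∈ι} ω_i = Id, and (b) Σ_{j∈ι} ℓ_j ω_i C_j⁺ = −ℓ_i C_i⁻ for every i ∈ ι. -/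
open Matrix BigOperators

/-- The negative part `C⁻ = O Λ⁻ Oᵀ` of the simultaneously diagonalized matrix
`C = O Λ Oᵀ`, where `Λ = diagonal d` and `(Λ⁻)_{kk} = min 0 (d k)`. -/
noncomputable def matNeg {m : ℕ} (O : Matrix (Fin m) (Fin m) ℝ) (d : Fin m → ℝ) :
    Matrix (Fin m) (Fin m) ℝ :=
  O * Matrix.diagonal (fun k => min 0 (d k)) * Oᵀ

/-- The positive part `C⁺ = O Λ⁺ Oᵀ`, where `(Λ⁺)_{kk} = max 0 (d k)`. -/
noncomputable def matPos {m : ℕ} (O : Matrix (Fin m) (Fin m) ℝ) (d : Fin m → ℝ) :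
    Matrix (Fin m) (Fin m) ℝ :=
  O * Matrix.diagonal (fun k => max 0 (d k)) * Oᵀ

/-- the paper's weights `ω i = ℓ i • C i⁻ * S⁻¹` with
`S = ∑ k, ℓ k • C k⁻` satisfy (a) the normalization condition `∑ i, ω i = 1`
and (b) the flux-distribution condition `∑ j, ℓ j • (ω i * C j⁺) = -(ℓ i • C i⁻)`,
provided `∑ j, ℓ j • C j = 0` (closedness of the cell) and `S` is invertible.
Here `C j = O (diagonal (d j)) Oᵀ` are simultaneously diagonalizable flux matrices,
`O` orthogonal, and `ℓ j > 0` are the face measures. -/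
theorem stmt_5 (m : ℕ) (ι : Type) [Fintype ι]
    (O : Matrix (Fin m) (Fin m) ℝ) (hO : O * Oᵀ = 1)
    (d : ι → Fin m → ℝ) (ℓ : ι → ℝ) (hℓ : ∀ j, 0 < ℓ j)
    (hclosed : ∑ j, ℓ j • (O * Matrix.diagonal (d j) * Oᵀ) = 0)
    (hS : IsUnit (∑ k, ℓ k • matNeg O (d k))) :
    (∑ i, (ℓ i • matNeg O (d i)) * (∑ k, ℓ k • matNeg O (d k))⁻¹ = 1)
    ∧ ∀ i, ∑ j, ℓ j • (((ℓ i • matNeg O (d i)) * (∑ k, ℓ k • matNeg O (d k))⁻¹)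
            * matPos O (d j))
        = -(ℓ i • matNeg O (d i)) := by
  have hdet := (Matrix.isUnit_iff_isUnit_det _).mp hS
  have hP : ∑ j, ℓ j • matPos O (d j) = -∑ k, ℓ k • matNeg O (d k) := by
    rw [eq_neg_iff_add_eq_zero, ← Finset.sum_add_distrib, ← hclosed]
    refine Finset.sum_congr rfl fun j _ => ?_
    rw [← smul_add, matPos, matNeg, ← add_mul, ← mul_add, Matrix.diagonal_add]
    congr 4
    funext k
    rw [max_add_min, zero_add]
  refine ⟨?_, fun i => ?_⟩
  · rw [← Finset.sum_mul, Matrix.mul_nonsing_inv _ hdet]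
  · simp only [← Matrix.mul_smul]
    rw [← Finset.mul_sum, hP, mul_neg, Matrix.mul_assoc, Matrix.nonsing_inv_mul _ hdet, Matrix.mul_one]
end

section
/- Let ι be a finite index set. Let O be a real orthogonal m×m matrix and for each j ∈ ι let Λ_j be a real diagonal m×m matrix; set C_j⁺ := O Λ_j⁺ Oᵀ and C_j⁻ := O Λ_j⁻ Oᵀ, where (Λ_j⁺)_{kk} = max(0, (Λ_j)_{kk}) and (Λ_j⁻)_{kk} = min(0, (Λ_j)_{kk}). Let ℓ_j > 0 for each j ∈ ι and assume S := Σ_{k∈ι} ℓ_k C_k⁻ is invertible. Define ω_i := ℓ_i C_i⁻ S⁻¹. Then for all i, j ∈ ι, the matrix ω_i C_j⁺ is symmetric and positive semidefinite. -/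
open Matrix BigOperators

/-- for the paper's weights `ω i = ℓ i • C i⁻ * S⁻¹` with
`S = ∑ k, ℓ k • C k⁻` invertible, each product `ω i * C j⁺` is symmetric and
positive semidefinite. -/
theorem stmt_6 (m : ℕ) (ι : Type) [Fintype ι]
    (O : Matrix (Fin m) (Fin m) ℝ) (hO : O * Oᵀ = 1)
    (d : ι → Fin m → ℝ) (ℓ : ι → ℝ) (hℓ : ∀ j, 0 < ℓ j)
    (hS : IsUnit (∑ k, ℓ k • matNeg O (d k))) :
    ∀ i j : ι,
      ((((ℓ i • matNeg O (d i)) * (∑ k, ℓ k • matNeg O (d k))⁻¹) * matPos O (d j))ᵀ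
          = ((ℓ i • matNeg O (d i)) * (∑ k, ℓ k • matNeg O (d k))⁻¹) * matPos O (d j))
      ∧ ∀ x : Fin m → ℝ,
          0 ≤ x ⬝ᵥ ((((ℓ i • matNeg O (d i)) * (∑ k, ℓ k • matNeg O (d k))⁻¹)
              * matPos O (d j)).mulVec x) := by
  have hO' : Oᵀ * O = 1 := mul_eq_one_comm.mp hO
  have hmul : ∀ a b : Fin m → ℝ, (O * diagonal a * Oᵀ) * (O * diagonal b * Oᵀ)
      = O * diagonal (fun k => a k * b k) * Oᵀ := by
    intro a b
    calc (O * diagonal a * Oᵀ) * (O * diagonal b * Oᵀ)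
        = O * diagonal a * (Oᵀ * O) * diagonal b * Oᵀ := by simp only [Matrix.mul_assoc]
      _ = _ := by rw [hO', Matrix.mul_one, Matrix.mul_assoc O, diagonal_mul_diagonal]
  have hsm : ∀ k, ℓ k • matNeg O (d k)
      = O * diagonal (fun n => ℓ k * min 0 (d k n)) * Oᵀ := by
    intro k
    have : diagonal (fun n => ℓ k * min 0 (d k n))
        = ℓ k • diagonal (fun n => min 0 (d k n)) := by
      rw [← diagonal_smul]; rfl
    rw [this, matNeg, Matrix.mul_smul, Matrix.smul_mul]
  set s : Fin m → ℝ := fun n => ∑ k, ℓ k * min 0 (d k n) with hs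
  have hsum : ∑ k, ℓ k • matNeg O (d k) = O * diagonal s * Oᵀ := by
    have : diagonal s = ∑ k, diagonal (fun n => ℓ k * min 0 (d k n)) := by
      ext a b
      rw [Matrix.sum_apply]
      by_cases h : a = b
      · subst h; simp [hs]
      · simp [h]
    rw [this, Matrix.mul_sum, Matrix.sum_mul]
    exact Finset.sum_congr rfl fun k _ => hsm k
  rw [hsum] at hS ⊢
  have hne : ∀ n, s n ≠ 0 := by
    have h1 : IsUnit (diagonal s) := by
      have hu : IsUnit O := IsUnit.of_mul_eq_one _ hO
      have hu' : IsUnit Oᵀ := IsUnit.of_mul_eq_one _ hO'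
      have := (hu'.mul hS).mul hu
      have e : Oᵀ * (O * diagonal s * Oᵀ) * O = (Oᵀ * O) * diagonal s * (Oᵀ * O) := by
        simp only [Matrix.mul_assoc]
      rwa [e, hO', Matrix.one_mul, Matrix.mul_one] at this
    rw [Matrix.isUnit_diagonal, Pi.isUnit_iff] at h1
    exact fun n => (h1 n).ne_zero
  have hinv : (O * diagonal s * Oᵀ)⁻¹ = O * diagonal (fun n => (s n)⁻¹) * Oᵀ := by
    apply Matrix.inv_eq_right_inv
    rw [hmul]
    have : (fun k => s k * (s k)⁻¹) = fun _ => (1 : ℝ) := by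
      funext k; exact mul_inv_cancel₀ (hne k)
    rw [this, diagonal_one, Matrix.mul_one, hO]
  have hsn : ∀ n, s n ≤ 0 := fun n => Finset.sum_nonpos fun k _ =>
    mul_nonpos_of_nonneg_of_nonpos (hℓ k).le (min_le_left _ _)
  intro i j
  rw [hinv, hsm i, matPos, hmul, hmul]
  refine ⟨?_, fun x => ?_⟩
  · simp [Matrix.transpose_mul, Matrix.mul_assoc]
  · rw [← Matrix.mulVec_mulVec, ← Matrix.mulVec_mulVec, Matrix.dotProduct_mulVec,
      ← Matrix.mulVec_transpose]
    refine Finset.sum_nonneg fun n _ => ?_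
    rw [Matrix.mulVec_diagonal]
    have h1 : 0 ≤ ℓ i * min 0 (d i n) * (s n)⁻¹ :=
      mul_nonneg_of_nonpos_of_nonpos
        (mul_nonpos_of_nonneg_of_nonpos (hℓ i).le (min_le_left _ _)) (inv_nonpos.2 (hsn n))
    have h2 : 0 ≤ ℓ i * min 0 (d i n) * (s n)⁻¹ * max 0 (d j n) :=
      mul_nonneg h1 (le_max_left _ _)
    have h3 := mul_nonneg h2 (mul_self_nonneg ((Oᵀ *ᵥ x) n))
    linarith
end

section
/- Let ι be a finite index set. Let β ∈ ℝ² and for each j ∈ ι let n_j ∈ ℝ² and ℓ_j > 0, and assume Σ_{j∈ι} ℓ_j n_j = 0 and Σ_{k∈ι} ℓ_k min(⟨β, n_k⟩, 0) ≠ 0. For i ∈ ι define ω_i := ℓ_i min(⟨β, n_i⟩, 0) / (Σ_{k∈ι} ℓ_k min(⟨β, n_k⟩, 0)). Then: (a) 0 ≤ ω_i ≤ 1 for every i ∈ ι; (b) Σ_{i∈ι} ω_i = 1; (c) Σ_{j∈ι} ℓ_j ω_i max(⟨β, n_j⟩, 0) = −ℓ_i min(⟨β, n_i⟩, 0) for every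 i ∈ ι; and (d) ω_i = 0 whenever ⟨β, n_i⟩ ≥ 0. -/
open RealInnerProductSpace BigOperators

/-- scalar (linear advection) specialization of the DoD weight choice.
`β` is the advection velocity, `n j` the outward unit normals of the faces of a
cut-cell, `ℓ j > 0` the face measures with `∑ j, ℓ j • n j = 0`, and the total
inflow `∑ k, ℓ k * min ⟪β, n k⟫ 0` is nonzero. Then the weights
`ω i = ℓ i * min ⟪β, n i⟫ 0 / (∑ k, ℓ k * min ⟪β, n k⟫ 0)` satisfy:
(a) `0 ≤ ω i ≤ 1`; (b) `∑ i, ω i = 1`;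
(c) `∑ j, ℓ j * ω i * max ⟪β, n j⟫ 0 = -(ℓ i * min ⟪β, n i⟫ 0)`;
(d) `ω i = 0` whenever `0 ≤ ⟪β, n i⟫`. -/
theorem stmt_12 (ι : Type) [Fintype ι]
    (β : EuclideanSpace ℝ (Fin 2)) (n : ι → EuclideanSpace ℝ (Fin 2))
    (ℓ : ι → ℝ) (hℓ : ∀ j, 0 < ℓ j)
    (hclosed : ∑ j, ℓ j • n j = 0)
    (hS : ∑ k, ℓ k * min ⟪β, n k⟫ 0 ≠ 0) :
    (∀ i, 0 ≤ ℓ i * min ⟪β, n i⟫ 0 / (∑ k, ℓ k * min ⟪β, n k⟫ 0)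
        ∧ ℓ i * min ⟪β, n i⟫ 0 / (∑ k, ℓ k * min ⟪β, n k⟫ 0) ≤ 1)
    ∧ (∑ i, ℓ i * min ⟪β, n i⟫ 0 / (∑ k, ℓ k * min ⟪β, n k⟫ 0) = 1)
    ∧ (∀ i, ∑ j, ℓ j * (ℓ i * min ⟪β, n i⟫ 0 / (∑ k, ℓ k * min ⟪β, n k⟫ 0))
          * max ⟪β, n j⟫ 0
        = -(ℓ i * min ⟪β, n i⟫ 0))
    ∧ (∀ i, 0 ≤ ⟪β, n i⟫ →
        ℓ i * min ⟪β, n i⟫ 0 / (∑ k, ℓ k * min ⟪β, n k⟫ 0) = 0) := by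
  have hneg : ∀ k, ℓ k * min ⟪β, n k⟫ 0 ≤ 0 := fun k =>
    mul_nonpos_of_nonneg_of_nonpos (hℓ k).le (min_le_right _ _)
  have hmaxmin : ∑ j, ℓ j * max ⟪β, n j⟫ 0 = -∑ k, ℓ k * min ⟪β, n k⟫ 0 := by
    have h0 : ∑ j, ℓ j * ⟪β, n j⟫ = 0 := by
      have h := congrArg (fun v => ⟪β, v⟫) hclosed
      simpa only [inner_sum, inner_smul_right, inner_zero_right] using h
    have h1 : ∑ j, ℓ j * max ⟪β, n j⟫ 0 + ∑ k, ℓ k * min ⟪β, n k⟫ 0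
        = ∑ j, ℓ j * ⟪β, n j⟫ := by
      rw [← Finset.sum_add_distrib]
      refine Finset.sum_congr rfl fun j _ => ?_
      rw [← mul_add, max_add_min, add_zero]
    linarith
  have hSneg : ∑ k, ℓ k * min ⟪β, n k⟫ 0 < 0 :=
    lt_of_le_of_ne (Finset.sum_nonpos fun k _ => hneg k) hS
  refine ⟨fun i => ⟨div_nonneg_of_nonpos (hneg i) hSneg.le, ?_⟩, ?_, fun i => ?_, fun i hi => ?_⟩
  · rw [div_le_one_of_neg hSneg]
    have h := Finset.single_le_sum (f := fun k => -(ℓ k * min ⟪β, n k⟫ 0))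
      (fun k _ => neg_nonneg.mpr (hneg k)) (Finset.mem_univ i)
    rw [Finset.sum_neg_distrib] at h
    exact neg_le_neg_iff.mp h
  · rw [← Finset.sum_div, div_self hS]
  · generalize hT : ∑ k, ℓ k * min ⟪β, n k⟫ 0 = T at *
    have h : ∀ j, ℓ j * (ℓ i * min ⟪β, n i⟫ 0 / T) * max ⟪β, n j⟫ 0
        = (ℓ i * min ⟪β, n i⟫ 0 / T) * (ℓ j * max ⟪β, n j⟫ 0) := fun j => by ring
    rw [Finset.sum_congr rfl fun j _ => h j, ← Finset.mul_sum, hmaxmin, mul_neg,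
      div_mul_cancel₀ _ hS]
  · rw [min_eq_right hi, mul_zero, zero_div]
end
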